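/- (Lemma 2.4½: resolvent bound for the first perturbed operator on the contour C₁.) For sufficiently large k (depending only on l, δ, b₁, b₂, C_W) the following holds. Let x ∈ ℝ² with |x| = k satisfy | |x + p_m(0)|² − k² | > 2·k^{−4s₁−δ} for all m ∈ ℤ²∖{0}, and let y ∈ ℂ² with |y − x| ≤ 2·k^{−1−4s₁−2δ}. Then for every z ∈ ℂ with |z − k^{2l}| = k^{2l−2−4s₁−δ} and every g ∈ ℓ²(ℤ²;ℂ) there is a unique f ∈ ℓ²(ℤ²;ℂ) such that |y + p_m(0)|_*^{2l}·f_m + ∑_{q∈ℤ²} w_{m−q}·f_q − z·f_m = g_m for every m ∈ ℤ², and it satisfies ‖f‖_{ℓ²} ≤ 4·k^{−2l+2+4s₁+δ}·‖g‖_{ℓ²}. -/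

import Mathlib

open Real Set

noncomputable section

/-- `s₁ = (2l-11)/32`. -/
def s1 (l : ℕ) : ℝ := (2 * (l : ℝ) - 11) / 32

/-- The dual-lattice point `p_m(0) = (2πm₁/a₁, 2πm₂/a₂)`. -/
def pvec (a₁ a₂ : ℝ) (m : ℤ × ℤ) : ℝ × ℝ := (2 * π * m.1 / a₁, 2 * π * m.2 / a₂)

/-- Squared Euclidean norm on `ℝ²`. -/
def sq2 (v : ℝ × ℝ) : ℝ := v.1 ^ 2 + v.2 ^ 2

/-- The bilinear square `|y|²_* = y₁² + y₂²` on `ℂ²` (no conjugation). -/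
def nsq (v : ℂ × ℂ) : ℂ := v.1 ^ 2 + v.2 ^ 2

/-- Complexification of a real vector. -/
def cx (x : ℝ × ℝ) : ℂ × ℂ := ((x.1 : ℂ), (x.2 : ℂ))

/-- Euclidean norm on `ℂ²`. -/
def cnorm (v : ℂ × ℂ) : ℝ := Real.sqrt (‖v.1‖ ^ 2 + ‖v.2‖ ^ 2)

/-- `γ₀ = 2l - 2 - 4s₁ - 2δ`. -/
def gam0 (l : ℕ) (δ : ℝ) : ℝ := 2 * (l : ℝ) - 2 - 4 * s1 l - 2 * δ

/-- A solution `f ∈ ℓ²(ℤ²)` of the eigenvalue equation with diagonal part `pw`,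
off-diagonal matrix `M` (acting by convolution) and spectral parameter `lam`;
the series involved are required to converge absolutely. -/
def IsSolution (pw : ℤ × ℤ → ℂ) (M : ℤ × ℤ → ℂ) (lam : ℂ) (f : ℤ × ℤ → ℂ) : Prop :=
  Memℓp f 2 ∧ (∀ m : ℤ × ℤ, Summable fun q : ℤ × ℤ => ‖M (m - q) * f q‖) ∧
    ∀ m : ℤ × ℤ, pw m * f m + ∑' q : ℤ × ℤ, M (m - q) * f q = lam * f m

/-- `lam` is an eigenvalue: there is a nonzero `ℓ²` solution. -/
def IsEigenvalue (pw : ℤ × ℤ → ℂ) (M : ℤ × ℤ → ℂ) (lam : ℂ) : Prop :=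
  ∃ f : ℤ × ℤ → ℂ, IsSolution pw M lam f ∧ f ≠ 0

/-- `lam` is a simple eigenvalue: the space of `ℓ²` solutions is one-dimensional. -/
def IsSimpleEigenvalue (pw : ℤ × ℤ → ℂ) (M : ℤ × ℤ → ℂ) (lam : ℂ) : Prop :=
  ∃ f : ℤ × ℤ → ℂ, IsSolution pw M lam f ∧ f ≠ 0 ∧
    ∀ g : ℤ × ℤ → ℂ, IsSolution pw M lam g → ∃ c : ℂ, g = c • f

/-- Fourier coefficients of a periodic function `W` on the cell `[0,a₁] × [0,a₂]`. -/
def fCoeff (a₁ a₂ : ℝ) (W : ℝ × ℝ → ℝ) (j : ℤ × ℤ) : ℂ :=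
  ((a₁ * a₂ : ℝ) : ℂ)⁻¹ *
    ∫ x in Icc (0 : ℝ × ℝ) (a₁, a₂),
      (W x : ℂ) *
        Complex.exp (-Complex.I * (((pvec a₁ a₂ j).1 * x.1 + (pvec a₁ a₂ j).2 * x.2 : ℝ) : ℂ))

lemma norm_pow_succ_sub_le {u t : ℂ} {M : ℝ} (hu : ‖u‖ ≤ M) (ht : ‖t‖ ≤ M) (n : ℕ) :
    ‖u ^ (n + 1) - t ^ (n + 1)‖ ≤ (n + 1) * M ^ n * ‖u - t‖ := by
  have hM : 0 ≤ M := (norm_nonneg u).trans hu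
  induction n with
  | zero => simp
  | succ n ih =>
    have h : u ^ (n + 1 + 1) - t ^ (n + 1 + 1)
        = u * (u ^ (n + 1) - t ^ (n + 1)) + (u - t) * t ^ (n + 1) := by ring
    have h1 : ‖t ^ (n + 1)‖ ≤ M ^ (n + 1) := by
      rw [norm_pow]; exact pow_le_pow_left₀ (norm_nonneg _) ht _
    calc ‖u ^ (n + 1 + 1) - t ^ (n + 1 + 1)‖
        ≤ ‖u‖ * ‖u ^ (n + 1) - t ^ (n + 1)‖ + ‖u - t‖ * ‖t ^ (n + 1)‖ := by
          rw [h, ← norm_mul, ← norm_mul]; exact norm_add_le _ _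
      _ ≤ M * ((n + 1) * M ^ n * ‖u - t‖) + ‖u - t‖ * M ^ (n + 1) := by gcongr
      _ = ((n + 1 : ℕ) + 1) * M ^ (n + 1) * ‖u - t‖ := by push_cast; ring

lemma mul_abs_sub_le_abs_pow_succ_sub {t s : ℝ} (ht : 0 ≤ t) (hs : 0 ≤ s) (n : ℕ) :
    s ^ n * |t - s| ≤ |t ^ (n + 1) - s ^ (n + 1)| := by
  rcases le_total s t with h | h
  · have h1 : s ^ n ≤ t ^ n := pow_le_pow_left₀ hs h n
    rw [abs_of_nonneg (sub_nonneg.2 h)]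
    refine le_trans ?_ (le_abs_self _)
    nlinarith [pow_succ t n, pow_succ s n, mul_le_mul_of_nonneg_right h1 ht]
  · have h1 : t ^ n ≤ s ^ n := pow_le_pow_left₀ ht h n
    rw [abs_of_nonpos (sub_nonpos.2 h)]
    refine le_trans ?_ (neg_le_abs _)
    nlinarith [pow_succ t n, pow_succ s n, mul_le_mul_of_nonneg_right h1 ht]

lemma norm_nsq_le (h : ℂ × ℂ) : ‖nsq h‖ ≤ cnorm h ^ 2 := by
  rw [nsq, cnorm, Real.sq_sqrt (by positivity), ← norm_pow, ← norm_pow]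
  exact norm_add_le _ _

lemma norm_nsq_sub_sq2_le (X : ℝ × ℝ) (Y : ℂ × ℂ) :
    ‖nsq Y - (sq2 X : ℂ)‖ ≤ 2 * √(sq2 X) * cnorm (Y - cx X) + cnorm (Y - cx X) ^ 2 := by
  obtain ⟨h, rfl⟩ : ∃ h, Y = cx X + h := ⟨Y - cx X, by simp⟩
  have e : nsq (cx X + h) - (sq2 X : ℂ)
      = 2 * ((X.1 : ℂ) * h.1 + (X.2 : ℂ) * h.2) + nsq h := by
    simp only [nsq, cx, sq2, Prod.fst_add, Prod.snd_add]; push_cast; ring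
  have hcs : ‖(X.1 : ℂ) * h.1 + (X.2 : ℂ) * h.2‖ ≤ √(sq2 X) * cnorm h := by
    rw [sq2, cnorm, ← Real.sqrt_mul (by positivity)]
    refine Real.le_sqrt_of_sq_le ?_
    have h1 : ‖(X.1 : ℂ) * h.1 + (X.2 : ℂ) * h.2‖ ≤ |X.1| * ‖h.1‖ + |X.2| * ‖h.2‖ := by
      refine (norm_add_le _ _).trans_eq ?_
      simp
    calc ‖(X.1 : ℂ) * h.1 + (X.2 : ℂ) * h.2‖ ^ 2
        ≤ (|X.1| * ‖h.1‖ + |X.2| * ‖h.2‖) ^ 2 := by gcongr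
      _ ≤ (|X.1| ^ 2 + |X.2| ^ 2) * (‖h.1‖ ^ 2 + ‖h.2‖ ^ 2) := by
          nlinarith [sq_nonneg (|X.1| * ‖h.2‖ - |X.2| * ‖h.1‖)]
      _ = _ := by rw [sq_abs, sq_abs]
  rw [e, add_sub_cancel_left]
  refine (norm_add_le _ _).trans ?_
  rw [norm_mul, Complex.norm_ofNat]
  linarith [norm_nsq_le h]

lemma half_le_norm_nsq_pow_sub (n : ℕ) {k ε κ : ℝ} (hk : 20 ≤ k) (hε : 0 < ε) (hε1 : ε ≤ 1)
    (hκ : 40 * ((n + 1) * 5 ^ n) ≤ κ) {X : ℝ × ℝ} {Y : ℂ × ℂ}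
    (hY : cnorm (Y - cx X) ≤ 2 * (ε / (k * κ)))
    (hX : sq2 X = k ^ 2 ∨ 2 * ε < |sq2 X - k ^ 2|) {z : ℂ}
    (hz : ‖z - ((k ^ 2 : ℝ) : ℂ) ^ (n + 1)‖ = (k ^ 2) ^ n * ε) :
    (k ^ 2) ^ n * ε / 2 ≤ ‖nsq Y ^ (n + 1) - z‖ := by
  have hn5 : (1 : ℝ) ≤ (n + 1) * 5 ^ n :=
    one_le_mul_of_one_le_of_one_le (by simp) (one_le_pow₀ (by norm_num))
  have hκ0 : 40 ≤ κ := by linarith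
  have hk0 : 0 < k := by linarith
  have hκp : 0 < κ := by linarith
  have hR : 0 < (k ^ 2) ^ n * ε := by positivity
  set η := cnorm (Y - cx X) with hη
  have hη0 : 0 ≤ η := Real.sqrt_nonneg _
  have hkη : k * η ≤ 2 * (ε / κ) := by
    calc k * η ≤ k * (2 * (ε / (k * κ))) := by gcongr
      _ = 2 * (ε / κ) := by field_simp
  have hεκ : ε / κ ≤ 1 / 40 := by
    rw [div_le_div_iff₀ hκp (by norm_num)]; linarith
  have hη1 : η ≤ 1 := by nlinarith
  have ht0 : 0 ≤ sq2 X := by unfold sq2; positivity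
  have hr0 := Real.sqrt_nonneg (sq2 X)
  have hrt := Real.sq_sqrt ht0
  have hu := norm_nsq_sub_sq2_le X Y
  rw [← hη] at hu
  set r := √(sq2 X)
  set t := sq2 X
  set u := nsq Y
  have hnt : ‖(t : ℂ)‖ = t := by simp [abs_of_nonneg ht0]
  have hnk : ‖((k ^ 2 : ℝ) : ℂ) ^ (n + 1)‖ = (k ^ 2) ^ (n + 1) := by
    rw [norm_pow, Complex.norm_real, Real.norm_of_nonneg (by positivity)]
  rcases le_or_gt r (2 * k) with hr | hr
  · have hut : ‖u - t‖ ≤ 10 * (ε / κ) := by nlinarith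
    have htM : t ≤ 5 * k ^ 2 := by nlinarith
    have huM : ‖u‖ ≤ 5 * k ^ 2 := by
      have : ‖u‖ ≤ ‖u - t‖ + ‖(t : ℂ)‖ := by simpa using norm_add_le (u - t) (t : ℂ)
      nlinarith
    have h1 := norm_pow_succ_sub_le huM (hnt.trans_le htM) n
    have h2 : ‖u ^ (n + 1) - (t : ℂ) ^ (n + 1)‖ ≤ (k ^ 2) ^ n * ε / 4 := by
      calc _ ≤ (n + 1) * (5 * k ^ 2) ^ n * ‖u - t‖ := h1
        _ ≤ (n + 1) * (5 * k ^ 2) ^ n * (10 * (ε / κ)) := by gcongr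
        _ = (k ^ 2) ^ n * ε / 4 * (40 * ((n + 1) * 5 ^ n) / κ) := by
            rw [mul_pow]; field_simp; ring
        _ ≤ (k ^ 2) ^ n * ε / 4 * 1 := by
            gcongr; exact (div_le_one hκp).2 hκ
        _ = _ := mul_one _
    have h3 : (k ^ 2) ^ n * ε ≤ ‖(t : ℂ) ^ (n + 1) - z‖ := by
      rcases hX with hX | hX
      · rw [hX, norm_sub_rev, hz]
      · have h4 := mul_abs_sub_le_abs_pow_succ_sub ht0 (sq_nonneg k) n
        have h5 : ‖(t : ℂ) ^ (n + 1) - ((k ^ 2 : ℝ) : ℂ) ^ (n + 1)‖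
            = |t ^ (n + 1) - (k ^ 2) ^ (n + 1)| := by
          rw [← Complex.ofReal_pow, ← Complex.ofReal_pow, ← Complex.ofReal_sub, Complex.norm_real,
            Real.norm_eq_abs]
        have h6 := norm_sub_le_norm_sub_add_norm_sub ((t : ℂ) ^ (n + 1)) z
          (((k ^ 2 : ℝ) : ℂ) ^ (n + 1))
        have h7 : (k ^ 2) ^ n * (2 * ε) ≤ (k ^ 2) ^ n * |t - k ^ 2| := by gcongr
        linarith
    have h8 := norm_sub_le_norm_sub_add_norm_sub ((t : ℂ) ^ (n + 1)) (u ^ (n + 1)) z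
    rw [norm_sub_rev ((t : ℂ) ^ (n + 1)) (u ^ (n + 1))] at h8
    linarith
  · have hu2 : 2 * k ^ 2 ≤ ‖u‖ := by
      have : ‖(t : ℂ)‖ ≤ ‖(t : ℂ) - u‖ + ‖u‖ := by simpa using norm_add_le ((t : ℂ) - u) u
      rw [norm_sub_rev] at this
      nlinarith
    have h1 : 2 * (k ^ 2) ^ (n + 1) ≤ ‖u ^ (n + 1)‖ := by
      rw [norm_pow]
      calc 2 * (k ^ 2) ^ (n + 1) ≤ 2 ^ (n + 1) * (k ^ 2) ^ (n + 1) := by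
            gcongr; exact le_self_pow₀ (by norm_num) (by simp)
        _ = (2 * k ^ 2) ^ (n + 1) := (mul_pow _ _ _).symm
        _ ≤ _ := by gcongr
    have h2 : ‖u ^ (n + 1)‖ ≤ ‖u ^ (n + 1) - z‖ + ‖z‖ := by
      simpa using norm_add_le (u ^ (n + 1) - z) z
    have h3 : ‖z‖ ≤ ‖z - ((k ^ 2 : ℝ) : ℂ) ^ (n + 1)‖ + ‖((k ^ 2 : ℝ) : ℂ) ^ (n + 1)‖ := by
      have := norm_add_le (z - ((k ^ 2 : ℝ) : ℂ) ^ (n + 1)) (((k ^ 2 : ℝ) : ℂ) ^ (n + 1))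
      rwa [sub_add_cancel] at this
    have h4 : 2 * ((k ^ 2) ^ n * ε) ≤ (k ^ 2) ^ (n + 1) := by
      have : 2 * ε ≤ k ^ 2 := by nlinarith
      calc 2 * ((k ^ 2) ^ n * ε) = (k ^ 2) ^ n * (2 * ε) := by ring
        _ ≤ (k ^ 2) ^ n * k ^ 2 := by gcongr
        _ = (k ^ 2) ^ (n + 1) := (pow_succ _ _).symm
    linarith

open MeasureTheory

lemma exists_compression {ι H : Type*} [NormedAddCommGroup H] [InnerProductSpace ℂ H]
    [CompleteSpace H] {v : ι → H} (hv : Orthonormal ℂ v) (T : H →L[ℂ] H) :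
    ∃ A : lp (fun _ : ι => ℂ) 2 →L[ℂ] lp (fun _ : ι => ℂ) 2, ‖A‖ ≤ ‖T‖ ∧
      ∀ f m, HasSum (fun q => inner ℂ (v m) (T (v q)) * f q) (A f m) := by
  classical
  let V := hv.orthogonalFamily.linearIsometry
  refine ⟨V.toContinuousLinearMap.adjoint ∘L T ∘L V.toContinuousLinearMap, ?_, fun f m => ?_⟩
  · have hV : ‖V.toContinuousLinearMap‖ ≤ 1 := V.norm_toContinuousLinearMap_le
    refine (ContinuousLinearMap.opNorm_comp_le _ _).trans ?_
    rw [LinearIsometryEquiv.norm_map]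
    calc _ ≤ 1 * (‖T‖ * 1) := by
          gcongr
          refine (ContinuousLinearMap.opNorm_comp_le _ _).trans ?_
          gcongr
      _ = ‖T‖ := by ring
  · have h1 : ∀ (h : H) (m : ι), (V.toContinuousLinearMap.adjoint h) m = inner ℂ (v m) h := by
      intro h m
      have := ContinuousLinearMap.adjoint_inner_right V.toContinuousLinearMap
        (lp.single 2 m (1 : ℂ)) h
      rw [lp.inner_single_left] at this
      simpa [V] using this
    have h2 := hv.orthogonalFamily.hasSum_linearIsometry f
    have h3 := (h2.mapL T).mapL (innerSL ℂ (v m))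
    refine (congrArg₂ HasSum (funext fun q => ?_) (h1 (T (V f)) m).symm).mp h3
    simp [mul_comm]

lemma exists_mul_clm {α : Type*} [MeasurableSpace α] (μ : Measure α) {W : α → ℝ}
    (hW : Measurable W) {C : ℝ} (hC : 0 ≤ C) (hWC : ∀ x, |W x| ≤ C) :
    ∃ T : Lp ℂ 2 μ →L[ℂ] Lp ℂ 2 μ, ‖T‖ ≤ C ∧
      ∀ f : Lp ℂ 2 μ, T f =ᵐ[μ] fun x => (W x : ℂ) * f x := by
  have hle : ∀ (f : α → ℂ) x, ‖(W x : ℂ) * f x‖ ≤ C * ‖f x‖ := fun f x => by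
    rw [norm_mul, Complex.norm_real, Real.norm_eq_abs]
    exact mul_le_mul_of_nonneg_right (hWC x) (norm_nonneg _)
  have hmem : ∀ f : Lp ℂ 2 μ, MemLp (fun x => (W x : ℂ) * f x) 2 μ := fun f =>
    (Lp.memLp f).of_le_mul
      ((Complex.measurable_ofReal.comp hW).aestronglyMeasurable.mul (Lp.aestronglyMeasurable f))
      (Filter.Eventually.of_forall (hle f))
  let T₀ : Lp ℂ 2 μ →ₗ[ℂ] Lp ℂ 2 μ :=
    { toFun := fun f => (hmem f).toLp
      map_add' := fun f g => by
        rw [← MemLp.toLp_add]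
        refine MemLp.toLp_congr _ _ ?_
        filter_upwards [Lp.coeFn_add f g] with x hx
        rw [hx]
        exact mul_add _ _ _
      map_smul' := fun c f => by
        rw [RingHom.id_apply, ← MemLp.toLp_const_smul]
        refine MemLp.toLp_congr _ _ ?_
        filter_upwards [Lp.coeFn_smul c f] with x hx
        rw [hx]
        exact mul_left_comm _ _ _ }
  refine ⟨T₀.mkContinuous C fun f => ?_, LinearMap.mkContinuous_norm_le _ hC _, fun f => ?_⟩
  · refine Lp.norm_le_mul_norm_of_ae_le_mul ?_
    filter_upwards [(hmem f).coeFn_toLp] with x hx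
    change ‖(hmem f).toLp _ x‖ ≤ _
    rw [hx]
    exact hle f x
  · exact (hmem f).coeFn_toLp

lemma existsUnique_eq_sub_comp {E : Type*} [NormedAddCommGroup E] [NormedSpace ℂ E]
    [CompleteSpace E] (A T : E →L[ℂ] E) (h : ‖T‖ * ‖A‖ ≤ 1 / 2) (g : E) :
    ∃ f, f = T (g - A f) ∧ ‖f‖ ≤ 2 * ‖T‖ * ‖g‖ ∧ ∀ f', f' = T (g - A f') → f' = f := by
  have hTA : ∀ f, ‖T (A f)‖ ≤ 1 / 2 * ‖f‖ := fun f =>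
    calc ‖T (A f)‖ ≤ ‖T‖ * (‖A‖ * ‖f‖) := T.le_opNorm_of_le (A.le_opNorm f)
      _ = ‖T‖ * ‖A‖ * ‖f‖ := by ring
      _ ≤ _ := by gcongr
  have hc : ContractingWith (1 / 2) fun f => T (g - A f) := by
    refine ⟨by rw [← NNReal.coe_lt_coe]; norm_num, LipschitzWith.of_dist_le_mul fun a b => ?_⟩
    rw [dist_eq_norm, dist_eq_norm, ← map_sub, sub_sub_sub_cancel_left, ← map_sub,
      norm_sub_rev a b]
    simpa using hTA (b - a)
  refine ⟨hc.fixedPoint, hc.fixedPoint_isFixedPt.symm, ?_, fun f' hf' =>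
    hc.fixedPoint_unique hf'.symm⟩
  set f := hc.fixedPoint
  have hf : f = T (g - A f) := hc.fixedPoint_isFixedPt.symm
  have h1 : ‖f‖ ≤ ‖T‖ * ‖g‖ + 1 / 2 * ‖f‖ := by
    calc ‖f‖ = ‖T g - T (A f)‖ := by rw [← map_sub, ← hf]
      _ ≤ ‖T g‖ + ‖T (A f)‖ := norm_sub_le _ _
      _ ≤ _ := add_le_add (T.le_opNorm g) (hTA f)
  linarith

lemma exists_diagonal_clm {ι : Type*} {d : ι → ℂ} {ρ : ℝ} (hρ : 0 < ρ) (hd : ∀ m, ρ ≤ ‖d m‖) :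
    ∃ T : lp (fun _ : ι => ℂ) 2 →L[ℂ] lp (fun _ : ι => ℂ) 2, ‖T‖ ≤ ρ⁻¹ ∧
      ∀ f m, T f m = (d m)⁻¹ * f m := by
  have hK : ∀ m, ‖ContinuousLinearMap.mul ℂ ℂ (d m)⁻¹‖ ≤ ρ⁻¹ := fun m => by
    rw [ContinuousLinearMap.opNorm_mul_apply, norm_inv]
    exact inv_anti₀ hρ (hd m)
  have hρ' : 0 ≤ ρ⁻¹ := by positivity
  exact ⟨lp.mapCLM 2 (fun m => ContinuousLinearMap.mul ℂ ℂ (d m)⁻¹) hρ' hK,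
    lp.norm_mapCLM_le 2 _ hρ' hK, fun f m => rfl⟩

/-- The exponential `x ↦ exp(i⟨p_j(0), x⟩)`. -/
def planeWave (a₁ a₂ : ℝ) (j : ℤ × ℤ) (x : ℝ × ℝ) : ℂ :=
  Complex.exp (Complex.I * (((pvec a₁ a₂ j).1 * x.1 + (pvec a₁ a₂ j).2 * x.2 : ℝ) : ℂ))

/-- Normalized Lebesgue measure on the cell `[0,a₁] × [0,a₂]`. -/
def cellMeasure (a₁ a₂ : ℝ) : Measure (ℝ × ℝ) :=
  ENNReal.ofReal (a₁ * a₂)⁻¹ • volume.restrict (Icc (0 : ℝ × ℝ) (a₁, a₂))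

lemma integral_cellMeasure {a₁ a₂ : ℝ} (h₁ : 0 < a₁) (h₂ : 0 < a₂) (F : ℝ × ℝ → ℂ) :
    ∫ x, F x ∂cellMeasure a₁ a₂
      = ((a₁ * a₂ : ℝ) : ℂ)⁻¹ * ∫ x in Icc (0 : ℝ × ℝ) (a₁, a₂), F x := by
  rw [cellMeasure, integral_smul_measure, ENNReal.toReal_ofReal (by positivity),
    Complex.real_smul, Complex.ofReal_inv]

lemma isFiniteMeasure_cellMeasure (a₁ a₂ : ℝ) : IsFiniteMeasure (cellMeasure a₁ a₂) := by
  have : IsFiniteMeasure (volume.restrict (Icc (0 : ℝ × ℝ) (a₁, a₂))) :=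
    isFiniteMeasure_restrict.2 isCompact_Icc.measure_lt_top.ne
  exact Measure.smul_finite _ ENNReal.ofReal_ne_top

lemma conj_planeWave_mul (a₁ a₂ : ℝ) (m q : ℤ × ℤ) (x : ℝ × ℝ) :
    star (planeWave a₁ a₂ m x) * planeWave a₁ a₂ q x = planeWave a₁ a₂ (q - m) x := by
  simp only [planeWave, pvec, Complex.star_def, ← Complex.exp_conj, map_mul, Complex.conj_I,
    Complex.conj_ofReal, ← Complex.exp_add, Prod.fst_sub, Prod.snd_sub]
  push_cast
  ring_nf

lemma norm_planeWave (a₁ a₂ : ℝ) (j : ℤ × ℤ) (x : ℝ × ℝ) : ‖planeWave a₁ a₂ j x‖ = 1 := by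
  rw [planeWave, mul_comm, Complex.norm_exp_ofReal_mul_I]

lemma continuous_planeWave (a₁ a₂ : ℝ) (j : ℤ × ℤ) : Continuous (planeWave a₁ a₂ j) := by
  unfold planeWave; fun_prop

lemma memLp_planeWave (a₁ a₂ : ℝ) (j : ℤ × ℤ) :
    MemLp (planeWave a₁ a₂ j) 2 (cellMeasure a₁ a₂) :=
  have := isFiniteMeasure_cellMeasure a₁ a₂
  MemLp.of_bound (continuous_planeWave a₁ a₂ j).aestronglyMeasurable 1
    (Filter.Eventually.of_forall fun x => (norm_planeWave a₁ a₂ j x).le)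

lemma setIntegral_exp_period {a : ℝ} (ha : 0 < a) (n : ℤ) :
    ∫ x in Icc 0 a, Complex.exp (Complex.I * ((2 * π * n / a * x : ℝ) : ℂ))
      = if n = 0 then (a : ℂ) else 0 := by
  rw [integral_Icc_eq_integral_Ioc, ← intervalIntegral.integral_of_le ha.le]
  split_ifs with hn
  · simp [hn]
  · have ha' : (a : ℂ) ≠ 0 := by exact_mod_cast ha.ne'
    have hn' : (n : ℂ) ≠ 0 := by exact_mod_cast hn
    have hπ : (π : ℂ) ≠ 0 := by exact_mod_cast Real.pi_ne_zero
    have hc : (2 * π * n / a * Complex.I : ℂ) ≠ 0 := by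
      simp [ha', hn', hπ, Complex.I_ne_zero]
    have h := integral_exp_mul_complex (a := 0) (b := a) hc
    have e : (2 * π * n / a * Complex.I : ℂ) * a = n * (2 * π * Complex.I) := by
      field_simp
    rw [e, Complex.exp_int_mul_two_pi_mul_I] at h
    simp only [Complex.ofReal_zero, mul_zero, Complex.exp_zero, sub_self, zero_div] at h
    rw [← h]
    refine intervalIntegral.integral_congr fun x _ => ?_
    push_cast
    ring_nf

lemma integral_planeWave {a₁ a₂ : ℝ} (h₁ : 0 < a₁) (h₂ : 0 < a₂) (j : ℤ × ℤ) :
    ∫ x, planeWave a₁ a₂ j x ∂cellMeasure a₁ a₂ = if j = 0 then 1 else 0 := by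
  have e : ∀ x : ℝ × ℝ, planeWave a₁ a₂ j x
      = Complex.exp (Complex.I * ((2 * π * j.1 / a₁ * x.1 : ℝ) : ℂ))
        * Complex.exp (Complex.I * ((2 * π * j.2 / a₂ * x.2 : ℝ) : ℂ)) := fun x => by
    rw [← Complex.exp_add, ← mul_add, ← Complex.ofReal_add]; rfl
  simp_rw [integral_cellMeasure h₁ h₂, e]
  rw [Icc_prod_eq, Measure.volume_eq_prod,
    setIntegral_prod_mul (fun x : ℝ => Complex.exp (Complex.I * ((2 * π * j.1 / a₁ * x : ℝ) : ℂ)))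
      (fun x : ℝ => Complex.exp (Complex.I * ((2 * π * j.2 / a₂ * x : ℝ) : ℂ)))]
  have k₁ := setIntegral_exp_period h₁ j.1
  have k₂ := setIntegral_exp_period h₂ j.2
  simp only [Prod.fst_zero, Prod.snd_zero]
  rw [k₁, k₂]
  simp only [Prod.ext_iff, Prod.fst_zero, Prod.snd_zero]
  have h₁' : (a₁ : ℂ) ≠ 0 := by exact_mod_cast h₁.ne'
  have h₂' : (a₂ : ℂ) ≠ 0 := by exact_mod_cast h₂.ne'
  by_cases c₁ : j.1 = 0 <;> by_cases c₂ : j.2 = 0 <;> simp [c₁, c₂]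
  field_simp

lemma orthonormal_planeWave {a₁ a₂ : ℝ} (h₁ : 0 < a₁) (h₂ : 0 < a₂) :
    Orthonormal ℂ fun j => (memLp_planeWave a₁ a₂ j).toLp := by
  classical
  rw [orthonormal_iff_ite]
  intro m q
  rw [L2.inner_def]
  have : ∫ x, inner ℂ ((memLp_planeWave a₁ a₂ m).toLp (planeWave a₁ a₂ m) x)
        ((memLp_planeWave a₁ a₂ q).toLp (planeWave a₁ a₂ q) x) ∂cellMeasure a₁ a₂ = ∫ x, planeWave a₁ a₂ (q - m) x ∂cellMeasure a₁ a₂ := by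
    refine integral_congr_ae ?_
    filter_upwards [(memLp_planeWave a₁ a₂ m).coeFn_toLp, (memLp_planeWave a₁ a₂ q).coeFn_toLp]
      with x hm hq
    rw [hm, hq, ← conj_planeWave_mul, RCLike.inner_apply, mul_comm]
    rfl
  rw [this, integral_planeWave h₁ h₂]
  simp only [sub_eq_zero, eq_comm]

lemma exists_convolution_clm {a₁ a₂ : ℝ} (h₁ : 0 < a₁) (h₂ : 0 < a₂) {W : ℝ × ℝ → ℝ}
    (hW : Measurable W) {C : ℝ} (hC : 0 ≤ C) (hWC : ∀ x, |W x| ≤ C) :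
    ∃ A : lp (fun _ : ℤ × ℤ => ℂ) 2 →L[ℂ] lp (fun _ : ℤ × ℤ => ℂ) 2, ‖A‖ ≤ C ∧
      ∀ f m, HasSum (fun q => fCoeff a₁ a₂ W (m - q) * f q) (A f m) := by
  obtain ⟨T, hTC, hT⟩ := exists_mul_clm (cellMeasure a₁ a₂) hW hC hWC
  obtain ⟨A, hA, hAf⟩ := exists_compression (orthonormal_planeWave h₁ h₂) T
  refine ⟨A, hA.trans hTC, fun f m => ?_⟩
  convert hAf f m using 3 with q
  rw [L2.inner_def, fCoeff, ← integral_cellMeasure h₁ h₂]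
  refine integral_congr_ae ?_
  filter_upwards [(memLp_planeWave a₁ a₂ m).coeFn_toLp, (memLp_planeWave a₁ a₂ q).coeFn_toLp,
    hT (memLp_planeWave a₁ a₂ q).toLp] with x hm hq hx
  have e := conj_planeWave_mul a₁ a₂ m q x
  rw [hm, hx, hq, RCLike.inner_apply, mul_assoc, mul_comm (planeWave a₁ a₂ q x)]
  have e' : (starRingEnd ℂ) (planeWave a₁ a₂ m x) * planeWave a₁ a₂ q x
      = planeWave a₁ a₂ (q - m) x := e
  rw [e', planeWave, ← neg_sub q m]
  congr 2
  simp only [pvec, Prod.fst_neg, Prod.snd_neg]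
  push_cast
  ring

/-- Lemma 2.4½: resolvent bound for the first perturbed operator on the contour `C₁`. -/
theorem statement7 (l : ℕ) (hl : 6 ≤ l) (δ b₁ b₂ C_W : ℝ)
    (hδ : 0 < δ) (hδ' : 2 * δ < 2 * (l : ℝ) - 2 - 4 * s1 l)
    (hb₁ : 0 < b₁) (hb₂ : 0 < b₂) :
    ∃ k₀ : ℝ, ∀ k : ℝ, k₀ < k → 1 < k →
    ∀ a₁ a₂ : ℝ,
      k ^ s1 l * b₁ / 4 ≤ a₁ → a₁ ≤ k ^ s1 l * b₁ →
      k ^ s1 l * b₂ / 4 ≤ a₂ → a₂ ≤ k ^ s1 l * b₂ →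
    ∀ W : ℝ × ℝ → ℝ, Measurable W → (∀ x, |W x| ≤ C_W) →
      (∀ x, W (x + (a₁, 0)) = W x) → (∀ x, W (x + (0, a₂)) = W x) →
      (∫ x in Icc (0 : ℝ × ℝ) (a₁, a₂), W x) = 0 →
    ∀ w : ℤ × ℤ → ℂ, (∀ j, w j = fCoeff a₁ a₂ W j) →
    ∀ x : ℝ × ℝ, sq2 x = k ^ 2 →
      (∀ m : ℤ × ℤ, m ≠ 0 →
        2 * k ^ (-4 * s1 l - δ) < |sq2 (x + pvec a₁ a₂ m) - k ^ 2|) →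
    ∀ y : ℂ × ℂ, cnorm (y - cx x) ≤ 2 * k ^ (-1 - 4 * s1 l - 2 * δ) →
    ∀ z : ℂ, ‖z - ((k ^ (2 * (l : ℝ)) : ℝ) : ℂ)‖ = k ^ (2 * (l : ℝ) - 2 - 4 * s1 l - δ) →
    ∀ g : lp (fun _ : ℤ × ℤ => ℂ) 2,
      ∃ f : lp (fun _ : ℤ × ℤ => ℂ) 2,
        ((∀ m : ℤ × ℤ, Summable fun q : ℤ × ℤ => ‖w (m - q) * f q‖) ∧
          ∀ m : ℤ × ℤ,
            nsq (y + cx (pvec a₁ a₂ m)) ^ l * f m + (∑' q : ℤ × ℤ, w (m - q) * f q) - z * f m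
              = g m) ∧
        ‖f‖ ≤ 4 * k ^ (-2 * (l : ℝ) + 2 + 4 * s1 l + δ) * ‖g‖ ∧
        ∀ f' : lp (fun _ : ℤ × ℤ => ℂ) 2,
          ((∀ m : ℤ × ℤ, Summable fun q : ℤ × ℤ => ‖w (m - q) * f' q‖) ∧
            ∀ m : ℤ × ℤ,
              nsq (y + cx (pvec a₁ a₂ m)) ^ l * f' m + (∑' q : ℤ × ℤ, w (m - q) * f' q) - z * f' m
                = g m) →
          f' = f := by
  obtain ⟨n, rfl⟩ : ∃ n, l = n + 1 := ⟨l - 1, by omega⟩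
  have hs : 0 ≤ s1 (n + 1) := by
    have : (6 : ℝ) ≤ ((n + 1 : ℕ) : ℝ) := by exact_mod_cast hl
    unfold s1
    linarith
  generalize s1 (n + 1) = s at hs hδ' ⊢
  have hev := (Filter.eventually_ge_atTop (20 : ℝ)).and
    ((tendsto_rpow_atTop hδ).eventually_ge_atTop (max (4 * C_W) (40 * ((n + 1) * 5 ^ n))))
  obtain ⟨k₀, hk₀⟩ := Filter.eventually_atTop.1 hev
  refine ⟨k₀, fun k hk hk1 a₁ a₂ ha₁ _ ha₂ _ W hWm hWC _ _ _ w hw x hx hxm y hy z hz g => ?_⟩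
  obtain ⟨hk20, hkδ⟩ := hk₀ k hk.le
  obtain ⟨hκC, hκn⟩ := max_le_iff.1 hkδ
  have hk0 : 0 < k := by linarith
  have hC : 0 ≤ C_W := (abs_nonneg _).trans (hWC 0)
  have ha₁0 : 0 < a₁ := lt_of_lt_of_le (by positivity) ha₁
  have ha₂0 : 0 < a₂ := lt_of_lt_of_le (by positivity) ha₂
  set ε := k ^ (-4 * s - δ) with hε
  have hε0 : 0 < ε := by positivity
  have hε1 : ε ≤ 1 := Real.rpow_le_one_of_one_le_of_nonpos hk1.le (by linarith)
  have hpow : ∀ j : ℕ, k ^ (2 * (j : ℝ)) = (k ^ 2) ^ j := fun j => by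
    rw [Real.rpow_mul hk0.le, Real.rpow_natCast, Real.rpow_two]
  have hη : k ^ (-1 - 4 * s - 2 * δ) = ε / (k * k ^ δ) := by
    rw [hε, ← Real.rpow_one_add' hk0.le (by linarith), ← Real.rpow_sub hk0]
    ring_nf
  have hR : k ^ (2 * ((n + 1 : ℕ) : ℝ) - 2 - 4 * s - δ) = (k ^ 2) ^ n * ε := by
    rw [← hpow, hε, ← Real.rpow_add hk0]
    push_cast
    ring_nf
  have hRinv : k ^ (-2 * ((n + 1 : ℕ) : ℝ) + 2 + 4 * s + δ) = ((k ^ 2) ^ n * ε)⁻¹ := by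
    rw [← hR, ← Real.rpow_neg hk0.le]
    ring_nf
  have hκR : k ^ δ ≤ (k ^ 2) ^ n * ε := by
    rw [← hR]
    exact Real.rpow_le_rpow_of_exponent_le hk1.le (by linarith)
  rw [hη] at hy
  rw [hR, hpow, Complex.ofReal_pow] at hz
  rw [hRinv]
  set R := (k ^ 2) ^ n * ε with hRdef
  have hR0 : 0 < R := by positivity
  have hd : ∀ m, R / 2 ≤ ‖nsq (y + cx (pvec a₁ a₂ m)) ^ (n + 1) - z‖ := fun m => by
    refine half_le_norm_nsq_pow_sub n hk20 hε0 hε1 hκn (X := x + pvec a₁ a₂ m) ?_ ?_ hz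
    · have : y + cx (pvec a₁ a₂ m) - cx (x + pvec a₁ a₂ m) = y - cx x := by
        ext <;> simp [cx]
      rwa [this]
    · rcases eq_or_ne m 0 with rfl | hm
      · left
        rw [← hx]
        simp [pvec, sq2]
      · exact Or.inr (hxm m hm)
  obtain ⟨T, hT, hTf⟩ := exists_diagonal_clm (half_pos hR0) hd
  obtain ⟨A, hA, hAf⟩ := exists_convolution_clm ha₁0 ha₂0 hWm hC hWC
  simp only [← hw] at hAf
  have hTA : ‖T‖ * ‖A‖ ≤ 1 / 2 := by
    calc ‖T‖ * ‖A‖ ≤ (R / 2)⁻¹ * (R / 4) := by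
          gcongr
          linarith
      _ = 1 / 2 := by field_simp; norm_num
  have hd0 : ∀ m, nsq (y + cx (pvec a₁ a₂ m)) ^ (n + 1) - z ≠ 0 := fun m =>
    norm_pos_iff.1 ((half_pos hR0).trans_le (hd m))
  have hiff : ∀ f : lp (fun _ : ℤ × ℤ => ℂ) 2, f = T (g - A f) ↔
      ∀ m : ℤ × ℤ, nsq (y + cx (pvec a₁ a₂ m)) ^ (n + 1) * f m
        + (∑' q : ℤ × ℤ, w (m - q) * f q) - z * f m = g m := fun f => by
    rw [lp.ext_iff, funext_iff]
    refine forall_congr' fun m => ?_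
    rw [hTf, (hAf f m).tsum_eq, eq_inv_mul_iff_mul_eq₀ (hd0 m), lp.coeFn_sub, Pi.sub_apply,
      eq_sub_iff_add_eq]
    ring_nf
  obtain ⟨f, hf, hfn, hfu⟩ := existsUnique_eq_sub_comp A T hTA g
  refine ⟨f, ⟨fun m => (hAf f m).summable.norm, (hiff f).1 hf⟩, hfn.trans ?_,
    fun f' hf' => hfu f' ((hiff f').2 hf'.2)⟩
  refine mul_le_mul_of_nonneg_right ?_ (norm_nonneg g)
  calc 2 * ‖T‖ ≤ 2 * (R / 2)⁻¹ := by gcongr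
    _ = 4 * R⁻¹ := by field_simp; norm_num
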